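/- Let k be a field, G a finite group, and M a finite-dimensional kG-module. Then the space of G-invariants of the tensor algebra T_k(M), i.e. T_k(M)^G, is itself isomorphic as a graded k-algebra to a tensor algebra T_k(U) on a graded subspace U of T_k(M)^G (Kharchenko–Lane theorem). -/

import Mathlib

set_option synthInstance.maxHeartbeats 400000
set_option maxHeartbeats 800000

/-!
STATEMENT 0 (Kharchenko–Lane): Let `k` be a field, `G` a finite group, and `M` a
finite-dimensional `kG`-module.  Then the invariant subalgebra `T_k(M)^G` of the
tensor algebra is itself isomorphic, as a graded `k`-algebra, to the tensor algebra
`T_k(U)` on a homogeneous subspace `U` of `T_k(M)^G`.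
-/

open scoped DirectSum

section

variable {k G M : Type} [Field k] [Group G]
  [AddCommGroup M] [Module k M]

/-- The automorphism of the tensor algebra induced by the action of `g`. -/
noncomputable def tensorAction (ρ : Representation k G M) (g : G) :
    TensorAlgebra k M →ₐ[k] TensorAlgebra k M :=
  TensorAlgebra.lift k ((TensorAlgebra.ι k).comp (ρ g))

/-- The invariant (fixed-point) subalgebra `T_k(M)^G`. -/
noncomputable def tensorInvariants (ρ : Representation k G M) :
    Subalgebra k (TensorAlgebra k M) :=
  ⨅ g : G, AlgHom.equalizer (tensorAction ρ g) (AlgHom.id k (TensorAlgebra k M))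

/-- The `n`-th graded piece of the tensor algebra. -/
noncomputable def tensorGrade (n : ℕ) : Submodule k (TensorAlgebra k M) :=
  LinearMap.range (TensorAlgebra.ι k (M := M)) ^ n

end

section TensorGrading

variable {k M : Type} [Field k] [AddCommGroup M] [Module k M]

noncomputable instance tensorGradedAlgebra : GradedAlgebra (tensorGrade (k := k) (M := M)) :=
  TensorAlgebra.gradedAlgebra

lemma mem_tensorGrade_zero {a : TensorAlgebra k M} :
    a ∈ tensorGrade (k := k) (M := M) 0 ↔ ∃ r : k, algebraMap k _ r = a := by
  simp [tensorGrade, Submodule.mem_one]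

lemma tensorGrade_succ_induction {n : ℕ}
    {p : (a : TensorAlgebra k M) → a ∈ tensorGrade (k := k) (M := M) (n + 1) → Prop}
    (add : ∀ a ha b hb, p a ha → p b hb → p (a + b) (add_mem ha hb))
    (mul : ∀ (m : M) (a : TensorAlgebra k M) (ha : a ∈ tensorGrade (k := k) (M := M) n),
      p (TensorAlgebra.ι k m * a) (by
        rw [tensorGrade, pow_succ']; exact Submodule.mul_mem_mul ⟨m, rfl⟩ ha))
    {a : TensorAlgebra k M} (ha : a ∈ tensorGrade (k := k) (M := M) (n + 1)) : p a ha := by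
  have ha' := ha
  rw [tensorGrade, pow_succ'] at ha'
  induction ha' using Submodule.mul_induction_on' with
  | mem_mul_mem x hx y hy =>
    obtain ⟨m, rfl⟩ := hx
    exact mul m y hy
  | add x hx' y hy' hx hy =>
    rw [← pow_succ'] at hx' hy'
    exact add x hx' y hy' (hx hx') (hy hy')

lemma algebraMapInv_eq_zero_of_mem_tensorGrade {n : ℕ} (hn : 0 < n) {a : TensorAlgebra k M}
    (ha : a ∈ tensorGrade (k := k) (M := M) n) : TensorAlgebra.algebraMapInv a = 0 := by
  obtain ⟨n, rfl⟩ := Nat.exists_eq_succ_of_ne_zero hn.ne'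
  induction ha using tensorGrade_succ_induction with
  | add a _ b _ ha hb => rw [map_add, ha, hb, add_zero]
  | mul m a _ => simp [TensorAlgebra.algebraMapInv]

/-- The upper triangular representation of the tensor algebra encoding the left derivative
along `f`. -/
noncomputable def leftDerivHom (f : Module.Dual k M) :
    TensorAlgebra k M →ₐ[k] Matrix (Fin 2) (Fin 2) (TensorAlgebra k M) :=
  TensorAlgebra.lift k
    { toFun := fun m => !![0, algebraMap k _ (f m); 0, TensorAlgebra.ι k m]
      map_add' := fun x y => by ext i j; fin_cases i <;> fin_cases j <;> simp
      map_smul' := fun r x => by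
        ext i j; fin_cases i <;> fin_cases j <;> simp [Algebra.smul_def] }

lemma leftDerivHom_apply_one (f : Module.Dual k M) (a : TensorAlgebra k M) :
    leftDerivHom f a 1 0 = 0 ∧ leftDerivHom f a 1 1 = a := by
  induction a using TensorAlgebra.induction with
  | algebraMap r => simp [Matrix.algebraMap_matrix_apply]
  | ι m => simp [leftDerivHom]
  | mul a b ha hb => simp [Matrix.mul_apply, Fin.sum_univ_two, ha, hb]
  | add a b ha hb => simp [ha, hb]

/-- The left derivative along `f`: it removes the first tensor factor, pairing it with `f`. -/
noncomputable def leftDeriv (f : Module.Dual k M) : TensorAlgebra k M →ₗ[k] TensorAlgebra k M :=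
  Matrix.entryLinearMap k _ 0 1 ∘ₗ (leftDerivHom f).toLinearMap

lemma leftDeriv_ι_mul (f : Module.Dual k M) (m : M) (a : TensorAlgebra k M) :
    leftDeriv f (TensorAlgebra.ι k m * a) = f m • a := by
  have h : leftDeriv f (TensorAlgebra.ι k m * a) =
      (leftDerivHom f (TensorAlgebra.ι k m) * leftDerivHom f a) 0 1 := by
    rw [← map_mul]; rfl
  rw [h, Matrix.mul_apply, Fin.sum_univ_two, (leftDerivHom_apply_one f a).2]
  simp [leftDerivHom, Algebra.smul_def]

lemma leftDeriv_mem (f : Module.Dual k M) {n : ℕ} {a : TensorAlgebra k M}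
    (ha : a ∈ tensorGrade (k := k) (M := M) (n + 1)) :
    leftDeriv f a ∈ tensorGrade (k := k) (M := M) n := by
  induction ha using tensorGrade_succ_induction with
  | add a _ b _ ha hb => rw [map_add]; exact add_mem ha hb
  | mul m a ha => rw [leftDeriv_ι_mul]; exact Submodule.smul_mem _ _ ha

lemma leftDeriv_mul (f : Module.Dual k M) {n : ℕ} {a : TensorAlgebra k M}
    (ha : a ∈ tensorGrade (k := k) (M := M) (n + 1)) (b : TensorAlgebra k M) :
    leftDeriv f (a * b) = leftDeriv f a * b := by
  induction ha using tensorGrade_succ_induction with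
  | add x _ y _ hx hy => rw [add_mul, map_add, map_add, add_mul, hx, hy]
  | mul m x _ => rw [mul_assoc, leftDeriv_ι_mul, leftDeriv_ι_mul, smul_mul_assoc]

lemma eq_zero_of_leftDeriv_eq_zero [FiniteDimensional k M] {n : ℕ} {a : TensorAlgebra k M}
    (ha : a ∈ tensorGrade (k := k) (M := M) (n + 1)) (h : ∀ f, leftDeriv f a = 0) : a = 0 := by
  let B := Module.finBasis k M
  have key : a = ∑ i, TensorAlgebra.ι k (B i) * leftDeriv (B.coord i) a := by
    clear h
    induction ha using tensorGrade_succ_induction with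
    | add x _ y _ hx hy =>
      conv_lhs => rw [hx, hy]
      simp only [map_add, mul_add, Finset.sum_add_distrib]
    | mul m x _ =>
      conv_lhs => rw [← B.sum_repr m, map_sum, Finset.sum_mul]
      simp [leftDeriv_ι_mul]
  rw [key]
  simp [h]

/-- A nontrivial homogeneous left dependence relation may be stripped of left factors until one
of its coefficients has degree zero. -/
lemma exists_relation_of_degree [FiniteDimensional k M] {I : Type*} {s : Finset I}
    {u : I → TensorAlgebra k M} (d : I → ℕ) (n : ℕ) (b : I → TensorAlgebra k M)
    (hb : ∀ i ∈ s, b i ≠ 0 → ∃ e, e + d i = n ∧ b i ∈ tensorGrade (k := k) (M := M) e)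
    (hsum : ∑ i ∈ s, b i * u i = 0) (hne : ∃ i ∈ s, b i ≠ 0) :
    ∃ i₀ ∈ s, ∃ c : I → TensorAlgebra k M, c i₀ ≠ 0 ∧ ∑ i ∈ s, c i * u i = 0 ∧
      ∀ i ∈ s, c i ≠ 0 → ∃ e, e + d i = d i₀ ∧ c i ∈ tensorGrade (k := k) (M := M) e := by
  induction n generalizing b with
  | zero =>
    obtain ⟨i, hi, hbi⟩ := hne
    obtain ⟨e, he, -⟩ := hb i hi hbi
    exact ⟨i, hi, b, hbi, hsum, by simpa [show d i = 0 by omega] using hb⟩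
  | succ n ih =>
    by_cases hd : ∃ i ∈ s, b i ≠ 0 ∧ d i = n + 1
    · obtain ⟨i, hi, hbi, hdi⟩ := hd
      exact ⟨i, hi, b, hbi, hsum, hdi ▸ hb⟩
    · push Not at hd
      have hb' : ∀ i ∈ s, b i ≠ 0 →
          ∃ e, e + d i = n ∧ b i ∈ tensorGrade (k := k) (M := M) (e + 1) := by
        intro i hi hbi
        obtain ⟨e, he, hmem⟩ := hb i hi hbi
        have := hd i hi hbi
        obtain ⟨e, rfl⟩ := Nat.exists_eq_succ_of_ne_zero (show e ≠ 0 by omega)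
        exact ⟨e, by omega, hmem⟩
      obtain ⟨i, hi, hbi⟩ := hne
      obtain ⟨f, hf⟩ : ∃ f, leftDeriv f (b i) ≠ 0 := by
        obtain ⟨e, -, hmem⟩ := hb' i hi hbi
        by_contra! h
        exact hbi (eq_zero_of_leftDeriv_eq_zero hmem h)
      refine ih (fun j => leftDeriv f (b j)) (fun j hj hbj => ?_) ?_ ⟨i, hi, hf⟩
      · obtain ⟨e, he, hmem⟩ := hb' j hj (fun h => hbj (by simp [h]))
        exact ⟨e, he, leftDeriv_mem f hmem⟩
      · rw [← map_zero (leftDeriv f), ← hsum, map_sum]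
        refine Finset.sum_congr rfl fun j hj => ?_
        by_cases hbj : b j = 0
        · simp [hbj]
        · obtain ⟨e, -, hmem⟩ := hb' j hj hbj
          exact (leftDeriv_mul f hmem _).symm

/-- Homogeneous elements that are left dependent satisfy a relation whose coefficients are
homogeneous, one of them of degree zero. -/
lemma exists_homogeneous_relation [FiniteDimensional k M] {I : Type*} {s : Finset I}
    {u : I → TensorAlgebra k M} {d : I → ℕ} (hu : ∀ i, u i ∈ tensorGrade (k := k) (M := M) (d i))
    (h : ¬ LinearIndepOn (TensorAlgebra k M) u (s : Set I)) :
    ∃ i₀ ∈ s, ∃ c : I → TensorAlgebra k M, c i₀ ≠ 0 ∧ ∑ i ∈ s, c i * u i = 0 ∧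
      ∀ i ∈ s, c i ≠ 0 → ∃ e, e + d i = d i₀ ∧ c i ∈ tensorGrade (k := k) (M := M) e := by
  classical
  rw [not_linearIndepOn_finset_iff] at h
  obtain ⟨b, hsum, i, hi, hbi⟩ := h
  obtain ⟨e, he⟩ : ∃ e, DirectSum.decompose (tensorGrade (k := k) (M := M)) (b i) e ≠ 0 := by
    by_contra! h
    refine hbi ((DirectSum.decompose (tensorGrade (k := k) (M := M))).injective ?_)
    rw [DirectSum.decompose_zero]
    exact DFinsupp.ext h
  refine exists_relation_of_degree d (e + d i) (fun j => if d j ≤ e + d i then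
    (DirectSum.decompose (tensorGrade (k := k) (M := M)) (b j) (e + d i - d j) :
      TensorAlgebra k M) else 0) (fun j hj hbj => ?_) ?_ ⟨i, hi, by
      rw [if_pos (Nat.le_add_left _ _), Nat.add_sub_cancel]; simpa using he⟩
  · have hle : d j ≤ e + d i := by
      by_contra hle
      exact hbj (if_neg hle)
    exact ⟨e + d i - d j, by omega, by simp only [if_pos hle]; exact SetLike.coe_mem _⟩
  · have hproj := congrArg (GradedAlgebra.proj (tensorGrade (k := k) (M := M)) (e + d i)) hsum
    rw [map_sum, map_zero] at hproj
    refine Eq.trans (Finset.sum_congr rfl fun j _ => ?_) hproj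
    rw [smul_eq_mul, GradedAlgebra.proj_apply, DirectSum.coe_decompose_mul_of_right_mem _ _ (hu j)]
    split_ifs <;> simp

end TensorGrading

section FreeCriterion

variable {k W A J : Type*} [Field k] [AddCommGroup W] [Module k W] [Ring A] [Algebra k A]

lemma exists_mem_one_sup_range_pow (z : TensorAlgebra k W) :
    ∃ n, z ∈ (1 ⊔ LinearMap.range (TensorAlgebra.ι k (M := W))) ^ n := by
  induction z using TensorAlgebra.induction with
  | algebraMap r => exact ⟨0, by simp [Submodule.mem_one]⟩
  | ι x => exact ⟨1, by rw [pow_one]; exact Submodule.mem_sup_right ⟨x, rfl⟩⟩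
  | mul a b ha hb =>
    obtain ⟨m, hm⟩ := ha
    obtain ⟨n, hn⟩ := hb
    exact ⟨m + n, by rw [pow_add]; exact Submodule.mul_mem_mul hm hn⟩
  | add a b ha hb =>
    obtain ⟨m, hm⟩ := ha
    obtain ⟨n, hn⟩ := hb
    exact ⟨max m n, add_mem
      (SetLike.le_def.1 (pow_le_pow_right₀ le_sup_left (le_max_left m n)) hm)
      (SetLike.le_def.1 (pow_le_pow_right₀ le_sup_left (le_max_right m n)) hn)⟩

lemma one_sup_pow_succ_le (V : Submodule k A) (n : ℕ) :
    (1 ⊔ V) ^ (n + 1) ≤ 1 ⊔ (1 ⊔ V) ^ n * V := by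
  induction n with
  | zero => simp
  | succ n ih =>
    rw [pow_succ, Submodule.mul_sup, mul_one]
    refine sup_le (ih.trans (sup_le_sup_left ?_ _)) le_sup_right
    exact mul_le_mul_left (pow_le_pow_right₀ le_sup_left n.le_succ) V

lemma exists_finsupp_of_mem_mul_range {w : J → W} (hw : Submodule.span k (Set.range w) = ⊤)
    {P : Submodule k (TensorAlgebra k W)} {y : TensorAlgebra k W}
    (hy : y ∈ P * LinearMap.range (TensorAlgebra.ι k (M := W))) :
    ∃ p : J →₀ TensorAlgebra k W, (∀ j, p j ∈ P) ∧
      y = p.sum fun j a => a * TensorAlgebra.ι k (w j) := by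
  classical
  induction hy using Submodule.mul_induction_on' with
  | mem_mul_mem a ha _ hx =>
    obtain ⟨x, rfl⟩ := hx
    obtain ⟨c, rfl⟩ := Finsupp.mem_span_range_iff_exists_finsupp.1
      (show x ∈ Submodule.span k (Set.range w) from hw ▸ Submodule.mem_top)
    refine ⟨c.mapRange (fun r => r • a) (zero_smul _ _), fun j => ?_, ?_⟩
    · simpa using P.smul_mem _ ha
    · rw [Finsupp.sum_mapRange_index (by simp), Finsupp.sum, map_sum, Finset.mul_sum]
      simp [Finsupp.sum]
  | add x _ y _ hx hy =>
    obtain ⟨p, hp, rfl⟩ := hx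
    obtain ⟨q, hq, rfl⟩ := hy
    refine ⟨p + q, fun j => add_mem (hp j) (hq j), ?_⟩
    rw [Finsupp.sum_add_index (by simp) (by simp [add_mul])]

/-- A linear map from `W` to an augmented algebra `A`, with values in the augmentation ideal,
induces an injection of the tensor algebra if it sends a spanning family to a family that is left
linearly independent over `A`. -/
theorem lift_injective_of_linearIndependent (ε : A →ₐ[k] k) (f : W →ₗ[k] A) {w : J → W}
    (hw : Submodule.span k (Set.range w) = ⊤) (hε : ∀ j, ε (f (w j)) = 0)
    (hli : LinearIndependent A fun j => f (w j)) :
    Function.Injective (TensorAlgebra.lift k f) := by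
  have key (n : ℕ) : ∀ z ∈ (1 ⊔ LinearMap.range (TensorAlgebra.ι k (M := W))) ^ n,
      TensorAlgebra.lift k f z = 0 → z = 0 := by
    induction n with
    | zero =>
      intro z hz h
      rw [pow_zero, Submodule.mem_one] at hz
      obtain ⟨r, rfl⟩ := hz
      have := congrArg ε h
      simp only [AlgHom.commutes, map_zero] at this
      simp_all
    | succ n ih =>
      intro z hz h
      obtain ⟨_, hr, y, hy, rfl⟩ := Submodule.mem_sup.1 (one_sup_pow_succ_le _ n hz)
      obtain ⟨r, rfl⟩ := Submodule.mem_one.1 hr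
      obtain ⟨p, hp, rfl⟩ := exists_finsupp_of_mem_mul_range hw hy
      have hF : TensorAlgebra.lift k f (p.sum fun j a => a * TensorAlgebra.ι k (w j)) =
          p.sum fun j a => TensorAlgebra.lift k f a * f (w j) := by
        simp [Finsupp.sum, map_sum]
      rw [map_add, hF, AlgHom.commutes] at h
      have hr0 : r = 0 := by
        have := congrArg ε h
        simpa [Finsupp.sum, map_sum, hε] using this
      have hp0 := linearIndependent_iff.1 hli
        (p.mapRange (TensorAlgebra.lift k f) (map_zero _)) (by
          rw [Finsupp.linearCombination_apply, Finsupp.sum_mapRange_index (by simp)]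
          simpa [hr0] using h)
      have : p = 0 := by
        ext j
        exact ih _ (hp j) (by simpa using DFunLike.congr_fun hp0 j)
      simp [this, hr0]
  rw [injective_iff_map_eq_zero]
  intro z hz
  obtain ⟨n, hn⟩ := exists_mem_one_sup_range_pow z
  exact key n z hn hz

end FreeCriterion

section Invariants

variable {k G M : Type} [Field k] [Group G] [AddCommGroup M] [Module k M]

lemma mem_tensorInvariants {ρ : Representation k G M} {a : TensorAlgebra k M} :
    a ∈ tensorInvariants ρ ↔ ∀ g, tensorAction ρ g a = a := by
  simp [tensorInvariants, Algebra.mem_iInf, AlgHom.mem_equalizer]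

lemma tensorAction_mem (ρ : Representation k G M) (g : G) {n : ℕ} {a : TensorAlgebra k M}
    (ha : a ∈ tensorGrade (k := k) (M := M) n) :
    tensorAction ρ g a ∈ tensorGrade (k := k) (M := M) n := by
  have hle : (tensorGrade (k := k) (M := M) n).map (tensorAction ρ g).toLinearMap ≤
      tensorGrade (k := k) (M := M) n := by
    rw [tensorGrade, Submodule.map_pow]
    refine pow_le_pow_left' ?_ n
    rintro _ ⟨_, ⟨m, rfl⟩, rfl⟩
    exact ⟨ρ g m, by simp [tensorAction]⟩
  exact hle ⟨a, ha, rfl⟩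

lemma tensorAction_decompose (ρ : Representation k G M) (g : G) (a : TensorAlgebra k M) (n : ℕ) :
    tensorAction ρ g (DirectSum.decompose (tensorGrade (k := k) (M := M)) a n) =
      DirectSum.decompose (tensorGrade (k := k) (M := M)) (tensorAction ρ g a) n := by
  induction a using DirectSum.Decomposition.inductionOn (tensorGrade (k := k) (M := M)) with
  | zero => simp
  | add a b ha hb => simp [ha, hb]
  | @homogeneous i m =>
    by_cases h : i = n
    · subst h
      rw [DirectSum.decompose_of_mem_same _ m.2,
        DirectSum.decompose_of_mem_same _ (tensorAction_mem ρ g m.2)]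
    · rw [DirectSum.decompose_of_mem_ne _ m.2 h,
        DirectSum.decompose_of_mem_ne _ (tensorAction_mem ρ g m.2) h, map_zero]

/-- The `n`-th graded piece of the invariant subalgebra. -/
noncomputable def invariantGrade (ρ : Representation k G M) (n : ℕ) :
    Submodule k (TensorAlgebra k M) :=
  tensorGrade (k := k) n ⊓ Subalgebra.toSubmodule (tensorInvariants ρ)

lemma decompose_mem_invariantGrade (ρ : Representation k G M) {a : TensorAlgebra k M}
    (ha : a ∈ tensorInvariants ρ) (n : ℕ) :
    (DirectSum.decompose (tensorGrade (k := k) (M := M)) a n : TensorAlgebra k M) ∈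
      invariantGrade ρ n := by
  refine ⟨SetLike.coe_mem _, mem_tensorInvariants.2 fun g => ?_⟩
  rw [tensorAction_decompose, mem_tensorInvariants.1 ha g]

/-- The degree `n` invariants that are sums of products of invariants of smaller degree. -/
def decomposables (ρ : Representation k G M) (n : ℕ) : Submodule k (TensorAlgebra k M) :=
  Submodule.span k {x | ∃ i j, 0 < i ∧ 0 < j ∧ i + j = n ∧
    ∃ a ∈ invariantGrade ρ i, ∃ b ∈ invariantGrade ρ j, a * b = x}

lemma decomposables_le (ρ : Representation k G M) (n : ℕ) :
    decomposables ρ n ≤ invariantGrade ρ n := by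
  rw [decomposables, Submodule.span_le]
  rintro _ ⟨i, j, -, -, rfl, a, ha, b, hb, rfl⟩
  exact ⟨SetLike.mul_mem_graded ha.1 hb.1, (tensorInvariants ρ).mul_mem ha.2 hb.2⟩

/-- Homogeneous invariants of positive degree that are linearly independent modulo decomposable
invariants are left linearly independent over the tensor algebra. -/
theorem linearIndependent_of_notMem_decomposables [FiniteDimensional k M]
    (ρ : Representation k G M) {I : Type*} {u : I → TensorAlgebra k M} {d : I → ℕ}
    (hd : ∀ i, 0 < d i) (hu : ∀ i, u i ∈ invariantGrade ρ (d i))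
    (h : ∀ i, u i ∉ decomposables ρ (d i) ⊔ Submodule.span k (u '' {j | j ≠ i ∧ d j = d i})) :
    LinearIndependent (TensorAlgebra k M) u := by
  classical
  rw [linearIndependent_iff_finset_linearIndependent]
  intro s
  change LinearIndepOn (TensorAlgebra k M) u (s : Set I)
  induction s using Finset.strongInduction with
  | H s ih =>
  by_contra hdep
  obtain ⟨i, hi, c, hci, hsum, hc⟩ := exists_homogeneous_relation (fun j => (hu j).1) hdep
  obtain ⟨e, he, hmem⟩ := hc i hi hci
  obtain rfl : e = 0 := by omega
  obtain ⟨r, hr⟩ := mem_tensorGrade_zero.1 hmem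
  have hr0 : r ≠ 0 := by
    rintro rfl
    exact hci (by rw [← hr, map_zero])
  have hui : u i = ∑ j ∈ s.erase i, (-r⁻¹ • c j) * u j := by
    rw [← Finset.add_sum_erase _ _ hi, ← hr, ← Algebra.smul_def] at hsum
    have := congrArg (fun x => r⁻¹ • x) hsum
    simp only [smul_add, inv_smul_smul₀ hr0, smul_zero, Finset.smul_sum] at this
    rw [eq_neg_of_add_eq_zero_left this, ← Finset.sum_neg_distrib]
    simp
  have hinv (j : I) (hj : j ∈ s.erase i) : -r⁻¹ • c j ∈ tensorInvariants ρ := by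
    rw [mem_tensorInvariants]
    intro g
    rw [← sub_eq_zero]
    refine linearIndepOn_finset_iff.1 (ih _ (Finset.erase_ssubset hi))
      (fun j => tensorAction ρ g (-r⁻¹ • c j) - -r⁻¹ • c j) ?_ j hj
    have hg := mem_tensorInvariants.1 (hu i).2 g
    simp only [smul_eq_mul, sub_mul, Finset.sum_sub_distrib]
    rw [← hui, sub_eq_zero]
    conv_rhs => rw [← hg, hui, map_sum]
    exact Finset.sum_congr rfl fun j _ => by rw [map_mul, mem_tensorInvariants.1 (hu j).2 g]
  refine h i ?_
  rw [hui]
  refine Submodule.sum_mem _ fun j hj => ?_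
  by_cases hcj : c j = 0
  · simp [hcj]
  obtain ⟨e, he, hmem⟩ := hc j (Finset.mem_of_mem_erase hj) hcj
  rcases Nat.eq_zero_or_pos e with rfl | hpos
  · obtain ⟨r', hr'⟩ := mem_tensorGrade_zero.1 hmem
    refine Submodule.mem_sup_right ?_
    rw [smul_mul_assoc, ← hr', ← Algebra.smul_def]
    exact Submodule.smul_mem _ _ (Submodule.smul_mem _ _ (Submodule.subset_span
      ⟨j, ⟨Finset.ne_of_mem_erase hj, by omega⟩, rfl⟩))
  · exact Submodule.mem_sup_left (Submodule.subset_span ⟨e, d j, hpos, hd j, he, _,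
      ⟨Submodule.smul_mem _ _ hmem, hinv j hj⟩, _, hu j, rfl⟩)

/-- A subalgebra containing, in each positive degree, a complement of the decomposable invariants
contains all invariants. -/
lemma tensorInvariants_le_of_indecomposables (ρ : Representation k G M)
    {U : ℕ → Submodule k (TensorAlgebra k M)}
    (hU : ∀ n, 0 < n → decomposables ρ n ⊔ U n = invariantGrade ρ n)
    {S : Subalgebra k (TensorAlgebra k M)} (hS : ∀ n, U n ≤ Subalgebra.toSubmodule S) :
    tensorInvariants ρ ≤ S := by
  classical
  have key (n : ℕ) : invariantGrade ρ n ≤ Subalgebra.toSubmodule S := by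
    induction n using Nat.strong_induction_on with
    | _ n ih =>
      rcases Nat.eq_zero_or_pos n with rfl | hn
      · rintro a ⟨ha, -⟩
        obtain ⟨r, rfl⟩ := mem_tensorGrade_zero.1 ha
        exact S.algebraMap_mem r
      · rw [← hU n hn, decomposables]
        refine sup_le (Submodule.span_le.2 ?_) (hS n)
        rintro _ ⟨i, j, hi, hj, rfl, a, ha, b, hb, rfl⟩
        exact S.mul_mem (ih i (by omega) ha) (ih j (by omega) hb)
  intro a ha
  rw [← DirectSum.sum_support_decompose (tensorGrade (k := k) (M := M)) a]
  exact sum_mem fun n _ => key n (decompose_mem_invariantGrade ρ ha n)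

lemma exists_indecomposables (ρ : Representation k G M) (n : ℕ) :
    ∃ V : Submodule k (TensorAlgebra k M), V ≤ invariantGrade ρ n ∧
      Disjoint (decomposables ρ n) V ∧ (0 < n → decomposables ρ n ⊔ V = invariantGrade ρ n) ∧
      (n = 0 → V = ⊥) := by
  rcases Nat.eq_zero_or_pos n with rfl | hn
  · exact ⟨⊥, bot_le, disjoint_bot_right, by simp, fun _ => rfl⟩
  · obtain ⟨V, hV, hsup⟩ := IsModularLattice.exists_disjoint_and_sup_eq (decomposables_le ρ n)
    exact ⟨V, hsup ▸ le_sup_right, hV, fun _ => hsup, fun h => absurd h hn.ne'⟩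

end Invariants

/-- Kharchenko–Lane: the invariants of a homogeneous action of a finite group on a
tensor algebra on a finite-dimensional module form a tensor algebra on a graded
(homogeneous) subspace `U = ⨆ n, U n` of the invariants: the canonical algebra map
`T_k(U) → T_k(M)^G` extending the inclusion is bijective. -/
theorem kharchenko_lane
    {k G M : Type} [Field k] [Group G] [Finite G]
    [AddCommGroup M] [Module k M] [FiniteDimensional k M]
    (ρ : Representation k G M) :
    ∃ U : ℕ → Submodule k (TensorAlgebra k M),
      (∀ n, U n ≤ tensorGrade (k := k) n) ∧
      (∀ n, U n ≤ Subalgebra.toSubmodule (tensorInvariants ρ)) ∧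
      ∀ incl : (↥(⨆ n, U n)) →ₗ[k] ↥(tensorInvariants ρ),
        (∀ u : ↥(⨆ n, U n), (incl u : TensorAlgebra k M) = (u : TensorAlgebra k M)) →
        Function.Bijective (TensorAlgebra.lift k incl) := by
  choose U hle hdisj hsup hzero using exists_indecomposables ρ
  refine ⟨U, fun n => (hle n).trans inf_le_left, fun n => (hle n).trans inf_le_right,
    fun incl hincl => ?_⟩
  let B (n : ℕ) := Module.Basis.ofVectorSpace k (U n)
  let u (i : Σ n, Module.Basis.ofVectorSpaceIndex k (U n)) : TensorAlgebra k M := B i.1 i.2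
  have huU (i) : u i ∈ U i.1 := SetLike.coe_mem _
  have hspan (n : ℕ) : U n ≤ Submodule.span k (Set.range u) := by
    have h := congrArg (Submodule.map (U n).subtype) (B n).span_eq
    rw [Submodule.map_span, Submodule.map_top, Submodule.range_subtype] at h
    rw [← h]
    refine Submodule.span_mono ?_
    rintro _ ⟨_, ⟨j, rfl⟩, rfl⟩
    exact ⟨⟨n, j⟩, rfl⟩
  have hpos (i : Σ n, Module.Basis.ofVectorSpaceIndex k (U n)) : 0 < i.1 := by
    refine Nat.pos_of_ne_zero fun h0 => (B i.1).ne_zero i.2 ?_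
    have := huU i
    rw [hzero i.1 h0, Submodule.mem_bot] at this
    exact Subtype.ext this
  have hli : LinearIndependent (TensorAlgebra k M) u := by
    refine linearIndependent_of_notMem_decomposables ρ (d := Sigma.fst) hpos
      (fun i => hle _ (huU i)) ?_
    rintro ⟨n, j⟩ hmem
    obtain ⟨x, hx, y, hy, hxy⟩ := Submodule.mem_sup.1 hmem
    have hyspan : y ∈ Submodule.span k ((fun j' => (B n j' : TensorAlgebra k M)) '' {j}ᶜ) := by
      refine Submodule.span_mono ?_ hy
      rintro _ ⟨⟨n', j'⟩, ⟨hne, hn⟩, rfl⟩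
      obtain rfl : n' = n := hn
      exact ⟨j', fun h => hne (by rw [Set.mem_singleton_iff.1 h]), rfl⟩
    have hyU : y ∈ U n := by
      refine Submodule.span_le.2 ?_ hyspan
      rintro _ ⟨j', -, rfl⟩
      exact SetLike.coe_mem _
    have hx0 : x = 0 := Submodule.disjoint_def.1 (hdisj n) x hx
      (by rw [eq_sub_of_add_eq hxy]; exact sub_mem (huU ⟨n, j⟩) hyU)
    rw [hx0, zero_add] at hxy
    have hBli : LinearIndependent k fun j' => (B n j' : TensorAlgebra k M) :=
      (B n).linearIndependent.map' (U n).subtype (Submodule.ker_subtype _)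
    exact hBli.notMem_span_image (s := {j}ᶜ) (x := j) (by simp)
      (by rw [hxy] at hyspan; exact hyspan)
  have huW (i) : u i ∈ ⨆ n, U n := Submodule.mem_iSup_of_mem i.1 (huU i)
  have hcomp : (tensorInvariants ρ).val.comp (TensorAlgebra.lift k incl) =
      TensorAlgebra.lift k (⨆ n, U n).subtype := by
    ext x
    simp [hincl]
  constructor
  · have hinj : Function.Injective (TensorAlgebra.lift k (⨆ n, U n).subtype) := by
      refine lift_injective_of_linearIndependent TensorAlgebra.algebraMapInv _
        (w := fun i => (⟨u i, huW i⟩ : ↥(⨆ n, U n))) ?_ (fun i =>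
          algebraMapInv_eq_zero_of_mem_tensorGrade (hpos i) (hle _ (huU i)).1) hli
      refine Submodule.map_injective_of_injective (⨆ n, U n).injective_subtype ?_
      rw [Submodule.map_span, Submodule.map_top, Submodule.range_subtype, ← Set.range_comp]
      refine le_antisymm (Submodule.span_le.2 ?_) (iSup_le hspan)
      rintro _ ⟨i, rfl⟩
      exact huW i
    rw [← hcomp] at hinj
    exact Function.Injective.of_comp (f := (tensorInvariants ρ).val) hinj
  · rintro ⟨a, ha⟩
    have hS : tensorInvariants ρ ≤ ((tensorInvariants ρ).val.comp
        (TensorAlgebra.lift k incl)).range := by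
      refine tensorInvariants_le_of_indecomposables ρ hsup fun n x hx => ?_
      rw [hcomp]
      exact ⟨TensorAlgebra.ι k ⟨x, Submodule.mem_iSup_of_mem n hx⟩, by simp⟩
    obtain ⟨z, hz⟩ := hS ha
    exact ⟨z, Subtype.ext hz⟩
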